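/- arXiv:2405.06512 — 5 statements merged into one kernel-verified Lean document; each statement's English description precedes it below -/
import Mathlib

section
/- Let m ≥ 1, let λ_1, …, λ_m be nonzero, pairwise distinct algebraic complex numbers, and let p_1, …, p_m be nonzero polynomials with algebraic complex coefficients. Define u_n = Σ_{i=1}^m p_i(n)·λ_i^n for n ∈ ℕ, and let d = Σ_{i=1}^m (deg(p_i) + 1). Then there exists n with 0 ≤ n < d such that u_n ≠ 0; in particular, the sequence (u_n) is not identically zero. -/
open Polynomial in
/-- A polynomial that is invariant under the shift `X ↦ X + 1` and vanishes at `0` is zero. -/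
theorem Polynomial.eq_zero_of_taylor_one_eq_self {R : Type*} [CommRing R] [IsDomain R]
    [CharZero R] {p : R[X]} (hp : taylor 1 p = p) (h0 : p.eval 0 = 0) : p = 0 := by
  have hroot : ∀ n : ℕ, p.eval (n : R) = 0 := by
    intro n
    induction n with
    | zero => simpa using h0
    | succ n ih => rw [← ih, Nat.cast_succ, ← taylor_eval, hp]
  refine Polynomial.eq_zero_of_infinite_isRoot p
    ((Set.infinite_range_of_injective (Nat.cast_injective (R := R))).mono ?_)
  rintro _ ⟨n, rfl⟩
  exact hroot n

open Polynomial in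
/-- An exponential polynomial with distinct nonzero bases `lam i` and coefficients of degree less
than `k i` that vanishes at the first `∑ i, k i` natural numbers has all its coefficients zero. -/
theorem Polynomial.eq_zero_of_sum_eval_mul_pow_eq_zero {K ι : Type*} [Field K] [CharZero K]
    [Fintype ι] {lam : ι → K} (hlam : ∀ i, lam i ≠ 0) (hinj : Function.Injective lam)
    (k : ι → ℕ) (p : ι → K[X]) (hdeg : ∀ i, (p i).degree < k i)
    (hp : ∀ n < ∑ i, k i, ∑ i, (p i).eval (n : K) * lam i ^ n = 0) (i : ι) : p i = 0 := by
  classical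
  induction hd : ∑ i, k i generalizing k p i with
  | zero =>
    have hk : k i = 0 := Finset.sum_eq_zero_iff.1 hd i (Finset.mem_univ i)
    simpa [hk] using hdeg i
  | succ d ih =>
    obtain ⟨j, -, hj⟩ : ∃ j ∈ Finset.univ, k j ≠ 0 :=
      Finset.exists_ne_zero_of_sum_ne_zero (hd.trans_ne d.succ_ne_zero)
    have hq : ∀ i, C (lam i) * taylor 1 (p i) - C (lam j) * p i = 0 := by
      intro i
      refine ih (Function.update k j (k j - 1))
        (fun i ↦ C (lam i) * taylor 1 (p i) - C (lam j) * p i) ?_ ?_ i ?_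
      · intro i
        rcases eq_or_ne i j with rfl | hij
        · rw [Function.update_self, ← mul_sub, degree_C_mul (hlam i)]
          by_cases h0 : p i = 0
          · simp [h0, bot_lt_iff_ne_bot]
          have hlt : (taylor 1 (p i) - p i).degree < (p i).degree := by
            rw [← degree_taylor (p i) 1]
            exact degree_sub_lt_left (degree_taylor _ _) (by simpa using h0) (by simp)
          have hk := hdeg i
          rw [degree_eq_natDegree h0] at hk hlt
          refine hlt.trans_le ?_
          norm_cast at hk ⊢
          lia
        · rw [Function.update_of_ne hij]
          refine (degree_sub_le _ _).trans_lt (max_lt ?_ ?_)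
          · rw [degree_C_mul (hlam i), degree_taylor]
            exact hdeg i
          · rw [degree_C_mul (hlam j)]
            exact hdeg i
      · intro n hn
        have hsum : ∑ i, Function.update k j (k j - 1) i = d := by
          rw [Finset.sum_update_of_mem (Finset.mem_univ j)]
          rw [← Finset.add_sum_erase _ _ (Finset.mem_univ j), Finset.erase_eq] at hd
          lia
        have h1 := hp (n + 1) (by lia)
        have h2 := hp n (by lia)
        calc _ = ∑ i, (p i).eval ((n + 1 : ℕ) : K) * lam i ^ (n + 1) -
              lam j * ∑ i, (p i).eval (n : K) * lam i ^ n := by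
              rw [Finset.mul_sum, ← Finset.sum_sub_distrib]
              refine Finset.sum_congr rfl fun i _ ↦ ?_
              simp only [eval_sub, eval_mul, eval_C, taylor_eval]
              push_cast
              ring
          _ = 0 := by rw [h1, h2, mul_zero, sub_zero]
      · rw [Finset.sum_update_of_mem (Finset.mem_univ j)]
        rw [← Finset.add_sum_erase _ _ (Finset.mem_univ j), Finset.erase_eq] at hd
        lia
    have hne : ∀ i, i ≠ j → p i = 0 := by
      intro i hij
      have h := congrArg leadingCoeff (sub_eq_zero.1 (hq i))
      rw [leadingCoeff_mul, leadingCoeff_mul, leadingCoeff_taylor, leadingCoeff_C,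
        leadingCoeff_C] at h
      by_contra h0
      exact hij (hinj (mul_right_cancel₀ (leadingCoeff_ne_zero.2 h0) h))
    have hpj : p j = 0 := by
      refine eq_zero_of_taylor_one_eq_self
        (mul_left_cancel₀ (C_ne_zero.2 (hlam j)) (sub_eq_zero.1 (hq j))) ?_
      have h := hp 0 (by lia)
      rw [Finset.sum_eq_single j (fun i _ hij ↦ by simp [hne i hij]) (by simp)] at h
      simpa using h
    exact (eq_or_ne i j).elim (fun h ↦ h ▸ hpj) (hne i)


/-- If `u n = ∑ i, p_i(n) · λ_i^n` with `m ≥ 1`, the `λ_i` nonzero, pairwise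
distinct algebraic complex numbers and the `p_i` nonzero polynomials with algebraic complex
coefficients, then there exists `n < d := ∑ i (deg p_i + 1)` with `u n ≠ 0`. -/
theorem stmt_0 (m : ℕ) (hm : 1 ≤ m) (lam : Fin m → ℂ)
    (hlam_ne : ∀ i, lam i ≠ 0)
    (hlam_alg : ∀ i, IsAlgebraic ℚ (lam i))
    (hlam_inj : Function.Injective lam)
    (p : Fin m → Polynomial ℂ)
    (hp_ne : ∀ i, p i ≠ 0)
    (hp_alg : ∀ i k, IsAlgebraic ℚ ((p i).coeff k))
    (u : ℕ → ℂ)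
    (hu : ∀ n : ℕ, u n = ∑ i, (p i).eval (n : ℂ) * lam i ^ n)
    (d : ℕ) (hd : d = ∑ i, ((p i).natDegree + 1)) :
    ∃ n : ℕ, n < d ∧ u n ≠ 0 := by
  by_contra! h
  refine hp_ne ⟨0, hm⟩ (Polynomial.eq_zero_of_sum_eval_mul_pow_eq_zero hlam_ne hlam_inj
    (fun i ↦ (p i).natDegree + 1) p (fun i ↦ ?_) (fun n hn ↦ ?_) _)
  · exact Polynomial.degree_le_natDegree.trans_lt (by exact_mod_cast Nat.lt_succ_self _)
  · rw [← hu n]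
    exact h n (hd ▸ hn)
end

section
/- Let m ≥ 1, let λ_1, …, λ_m be nonzero, pairwise distinct algebraic complex numbers, let p_1, …, p_m be nonzero polynomials with algebraic complex coefficients, and set u_n = Σ_{i=1}^m p_i(n)·λ_i^n. If u_n is real for every n ∈ ℕ, then for every i with 1 ≤ i ≤ m there exists j with 1 ≤ j ≤ m such that λ_j is the complex conjugate of λ_i and p_j is obtained from p_i by conjugating all coefficients (i.e., p_j(n) = conj(p_i(n)) for all n). -/
/-- Powers of `shift - z` act on the sequence `f n * z ^ n` through iterated forward differences
of `f`. -/
theorem shift_sub_smul_pow_apply {R : Type*} [CommRing R] (z : R) (f : R → R) (k : ℕ) :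
    ((LinearMap.funLeft R R Nat.succ - z • (1 : Module.End R (ℕ → R))) ^ k)
        (fun n : ℕ ↦ f n * z ^ n) =
      fun n : ℕ ↦ z ^ k * (fwdDiff 1)^[k] f n * z ^ n := by
  induction k with
  | zero => simp
  | succ k ih =>
    rw [pow_succ', Module.End.mul_apply, ih, Function.iterate_succ_apply']
    funext n
    simp only [LinearMap.sub_apply, LinearMap.smul_apply, Module.End.one_apply, Pi.sub_apply,
      Pi.smul_apply, LinearMap.funLeft_apply, smul_eq_mul, fwdDiff, Nat.cast_succ,
      pow_succ]
    ring

theorem eval_mul_pow_mem_maxGenEigenspace {R : Type*} [CommRing R] (z : R) (q : Polynomial R) :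
    (fun n : ℕ ↦ q.eval (n : R) * z ^ n) ∈
      Module.End.maxGenEigenspace (LinearMap.funLeft R R Nat.succ) z := by
  refine (Module.End.mem_maxGenEigenspace _ _ _).2 ⟨q.natDegree + 1, ?_⟩
  rw [shift_sub_smul_pow_apply z (fun x ↦ q.eval x), q.fwdDiff_iter_degree_add_one_eq_zero]
  funext n
  simp

/-- An exponential polynomial with distinct nonzero bases that vanishes at every natural number
has all its coefficient polynomials equal to zero. -/
theorem eq_zero_of_sum_eval_mul_pow_eq_zero {K : Type*} [Field K] [CharZero K] (s : Finset K)
    (hs : ∀ z ∈ s, z ≠ 0) (q : K → Polynomial K)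
    (h : ∀ n : ℕ, ∑ z ∈ s, (q z).eval (n : K) * z ^ n = 0) : ∀ z ∈ s, q z = 0 := by
  intro z hz
  have hind := (iSupIndep_iff_finsetSum_eq_zero_imp_eq_zero _).1
    (Module.End.independent_maxGenEigenspace (LinearMap.funLeft K K Nat.succ))
  have hzero := hind s (fun z n ↦ (q z).eval (n : K) * z ^ n)
    (fun z _ ↦ eval_mul_pow_mem_maxGenEigenspace z (q z))
    (by funext n; simpa using h n) z hz
  refine Polynomial.eq_zero_of_infinite_isRoot _
    ((Set.infinite_range_of_injective (Nat.cast_injective (R := K))).mono ?_)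
  rintro _ ⟨n, rfl⟩
  exact (mul_eq_zero.1 (congrFun hzero n)).resolve_right (pow_ne_zero n (hs z hz))

/-- If `u n = ∑ i, p_i(n) · λ_i^n` (with the usual exponential-polynomial-form
assumptions) is real for every `n`, then for every `i` there is a `j` such that `λ_j` is the
complex conjugate of `λ_i` and `p_j` is obtained from `p_i` by conjugating all coefficients. -/
theorem stmt_1 (m : ℕ) (hm : 1 ≤ m) (lam : Fin m → ℂ)
    (hlam_ne : ∀ i, lam i ≠ 0)
    (hlam_alg : ∀ i, IsAlgebraic ℚ (lam i))
    (hlam_inj : Function.Injective lam)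
    (p : Fin m → Polynomial ℂ)
    (hp_ne : ∀ i, p i ≠ 0)
    (hp_alg : ∀ i k, IsAlgebraic ℚ ((p i).coeff k))
    (u : ℕ → ℂ)
    (hu : ∀ n : ℕ, u n = ∑ i, (p i).eval (n : ℂ) * lam i ^ n)
    (hreal : ∀ n : ℕ, (u n).im = 0) :
    ∀ i : Fin m, ∃ j : Fin m,
      lam j = (starRingEnd ℂ) (lam i) ∧
      p j = (p i).map (starRingEnd ℂ) := by
  classical
  let c := starRingEnd ℂ
  let q : ℂ → Polynomial ℂ := fun z ↦
    (∑ i, if lam i = z then p i else 0) - ∑ i, if c (lam i) = z then (p i).map c else 0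
  let s : Finset ℂ := Finset.univ.image lam ∪ Finset.univ.image fun i ↦ c (lam i)
  have hs : ∀ z ∈ s, z ≠ 0 := by
    simp only [s, Finset.mem_union, Finset.mem_image, Finset.mem_univ, true_and]
    rintro _ (⟨i, rfl⟩ | ⟨i, rfl⟩)
    · exact hlam_ne i
    · exact (map_ne_zero c).2 (hlam_ne i)
  have hlam_mem (i : Fin m) : lam i ∈ s :=
    Finset.mem_union_left _ (Finset.mem_image_of_mem _ (Finset.mem_univ i))
  have hconj_mem (i : Fin m) : c (lam i) ∈ s :=
    Finset.mem_union_right _ (Finset.mem_image_of_mem (fun i ↦ c (lam i)) (Finset.mem_univ i))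
  have hsum (μ : Fin m → ℂ) (hμ : ∀ i, μ i ∈ s) (r : Fin m → Polynomial ℂ) (n : ℕ) :
      ∑ z ∈ s, (∑ i, if μ i = z then r i else 0).eval (n : ℂ) * z ^ n =
        ∑ i, (r i).eval (n : ℂ) * μ i ^ n := by
    simp_rw [Polynomial.eval_finsetSum, Finset.sum_mul]
    rw [Finset.sum_comm]
    refine Finset.sum_congr rfl fun i _ ↦ ?_
    rw [Finset.sum_eq_single_of_mem (μ i) (hμ i) fun z _ hz ↦ by simp [hz.symm]]
    simp
  have hconj (n : ℕ) : ∑ i, ((p i).map c).eval (n : ℂ) * c (lam i) ^ n = u n := by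
    rw [← Complex.conj_eq_iff_im.2 (hreal n), hu n, map_sum]
    refine Finset.sum_congr rfl fun i _ ↦ ?_
    rw [map_mul, map_pow, ← Polynomial.eval_map_apply, map_natCast]
  have hq := eq_zero_of_sum_eval_mul_pow_eq_zero s hs q fun n ↦ by
    simp only [q, Polynomial.eval_sub, sub_mul, Finset.sum_sub_distrib]
    rw [hsum _ hlam_mem, hsum _ hconj_mem, hconj, ← hu, sub_self]
  intro i
  have hi : (∑ j, if lam j = c (lam i) then p j else 0) = (p i).map c := by
    have := sub_eq_zero.1 (hq _ (hconj_mem i))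
    simpa [c.injective.eq_iff, hlam_inj.eq_iff] using this
  obtain ⟨j, -, hj⟩ := Finset.exists_ne_zero_of_sum_ne_zero
    (hi.trans_ne ((Polynomial.map_ne_zero_iff c.injective).2 (hp_ne i)))
  have hj : lam j = c (lam i) := by
    by_contra h
    simp [h] at hj
  refine ⟨j, hj, ?_⟩
  rw [← hj] at hi
  simpa [hlam_inj.eq_iff] using hi
end

section
/- Let (u_n)_{n∈ℕ} be a linear recurrence sequence over ℚ. If the limit L = lim_{n→∞} u_n/n exists (as a real number), then L is rational. -/
open Filter Topology Polynomial

/-- The shift operator `(E v) n = v (n + 1)` on rational sequences. -/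
def seqShift : Module.End ℚ (ℕ → ℚ) := LinearMap.funLeft ℚ ℚ Nat.succ

lemma seqShift_apply (v : ℕ → ℚ) (n : ℕ) : seqShift v n = v (n + 1) := rfl

lemma seqShift_pow_apply (m : ℕ) (v : ℕ → ℚ) (n : ℕ) : (seqShift ^ m) v n = v (n + m) := by
  induction m generalizing n with
  | zero => simp
  | succ m ih =>
    rw [pow_succ', Module.End.mul_apply, seqShift_apply, ih]
    congr 1
    ring

lemma tendsto_add_div_of_tendsto_div {v : ℕ → ℚ} {M : ℝ} (m : ℕ)
    (h : Tendsto (fun n : ℕ => (v n : ℝ) / n) atTop (𝓝 M)) :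
    Tendsto (fun n : ℕ => (v (n + m) : ℝ) / n) atTop (𝓝 M) := by
  have h1 := (tendsto_add_atTop_iff_nat m).2 h
  have h2 : Tendsto (fun n : ℕ => 1 + (m : ℝ) / n) atTop (𝓝 1) := by
    simpa using (tendsto_const_div_atTop_nhds_zero_nat (m : ℝ)).const_add 1
  have h3 := h1.mul h2
  rw [mul_one] at h3
  refine h3.congr' ?_
  filter_upwards [eventually_gt_atTop 0] with n hn
  have hn' : (0 : ℝ) < n := by exact_mod_cast hn
  push_cast
  field_simp

/-- Applying a polynomial `r` in the shift multiplies the limit of `v n / n` by `r 1`. -/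
lemma tendsto_aeval_seqShift_div {v : ℕ → ℚ} {M : ℝ} (r : ℚ[X])
    (h : Tendsto (fun n : ℕ => (v n : ℝ) / n) atTop (𝓝 M)) :
    Tendsto (fun n : ℕ => (aeval seqShift r v n : ℝ) / n) atTop (𝓝 ((r.eval 1 : ℚ) * M)) := by
  induction r using Polynomial.induction_on' with
  | add p q hp hq =>
    simpa [add_div, add_mul] using hp.add hq
  | monomial m a =>
    have := (tendsto_add_div_of_tendsto_div m h).const_mul (a : ℝ)
    simpa [aeval_monomial, seqShift_pow_apply, Module.algebraMap_end_apply, mul_div_assoc]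
      using this

lemma tendsto_affine_div (c a : ℚ) :
    Tendsto (fun n : ℕ => ((c + a * n : ℚ) : ℝ) / n) atTop (𝓝 (a : ℝ)) := by
  have h : Tendsto (fun n : ℕ => (c : ℝ) / n + a) atTop (𝓝 (a : ℝ)) := by
    simpa using (tendsto_const_div_atTop_nhds_zero_nat (c : ℝ)).add_const (a : ℝ)
  refine h.congr' ?_
  filter_upwards [eventually_gt_atTop 0] with n hn
  have hn' : (0 : ℝ) < n := by exact_mod_cast hn
  push_cast
  field_simp

/-- A sequence of at most linear growth killed by a power of the difference operator is affine. -/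
lemma exists_affine_of_aeval_X_sub_one_pow_eq_zero (k : ℕ) {v : ℕ → ℚ} {M : ℝ}
    (h : Tendsto (fun n : ℕ => (v n : ℝ) / n) atTop (𝓝 M))
    (hk : aeval seqShift ((X - C 1 : ℚ[X]) ^ k) v = 0) :
    ∃ c a : ℚ, ∀ n : ℕ, v n = c + a * n := by
  induction k generalizing v M with
  | zero => exact ⟨0, 0, fun n => by simpa using congrFun hk n⟩
  | succ k ih =>
    have hd := tendsto_aeval_seqShift_div (X - C 1) h
    rw [pow_succ, map_mul, Module.End.mul_apply] at hk
    obtain ⟨c, a, hca⟩ := ih hd hk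
    simp only [hca] at hd
    have ha : (a : ℝ) = 0 := by
      simpa using tendsto_nhds_unique (tendsto_affine_div c a) hd
    have ha' : a = 0 := by exact_mod_cast ha
    refine ⟨v 0, c, fun n => ?_⟩
    induction n with
    | zero => simp
    | succ n ihn =>
      have := hca n
      simp [ha', seqShift_apply] at this
      push_cast
      linarith

/-- If `(u_n)` is a linear recurrence sequence over `ℚ` and the real limit
`L = lim_{n→∞} u_n / n` exists, then `L` is rational. -/
theorem stmt_4 (u : ℕ → ℚ)
    (hrec : ∃ D : ℕ, 1 ≤ D ∧ ∃ a : Fin D → ℚ,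
      ∀ n : ℕ, u (n + D) = ∑ i : Fin D, a i * u (n + (i : ℕ)))
    (L : ℝ)
    (hlim : Filter.Tendsto (fun n : ℕ => (u n : ℝ) / (n : ℝ)) Filter.atTop (nhds L)) :
    ∃ c : ℚ, L = (c : ℝ) := by
  obtain ⟨D, -, a, ha⟩ := hrec
  set p : ℚ[X] := X ^ D - ∑ i : Fin D, C (a i) * X ^ (i : ℕ) with hp
  have hp0 : p ≠ 0 := by
    intro h0
    have h1 : p.coeff D = 1 := by
      simp only [hp, coeff_sub, coeff_X_pow_self, finsetSum_coeff, coeff_C_mul, coeff_X_pow]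
      rw [Finset.sum_eq_zero, sub_zero]
      intro i _
      rw [if_neg i.2.ne', mul_zero]
    simp [h0] at h1
  have hpu : aeval seqShift p u = 0 := by
    funext n
    simp [hp, seqShift_pow_apply, Module.algebraMap_end_apply, ha]
  obtain ⟨q, hpq, hq⟩ := exists_eq_pow_rootMultiplicity_mul_and_not_dvd p hp0 1
  rw [dvd_iff_isRoot, IsRoot.def] at hq
  rw [hpq, map_mul, Module.End.mul_apply] at hpu
  have hv := tendsto_aeval_seqShift_div q hlim
  obtain ⟨c, b, hcb⟩ := exists_affine_of_aeval_X_sub_one_pow_eq_zero _ hv hpu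
  simp only [hcb] at hv
  have hb := tendsto_nhds_unique (tendsto_affine_div c b) hv
  have hq' : ((q.eval 1 : ℚ) : ℝ) ≠ 0 := by exact_mod_cast hq
  refine ⟨b / q.eval 1, ?_⟩
  push_cast
  rw [hb]
  field_simp
end

section
/- Let λ_1, …, λ_ℓ be algebraic complex numbers with λ_i = ρ_i·γ_i where ρ_i > 0 is real, |γ_i| = 1 and γ_i = e^{2πi·θ_i} is algebraic with θ_i ∈ [0,1). Then there exist integers R ≥ 1 and m with 0 ≤ m ≤ ℓ, reals ϑ_1, …, ϑ_m ∈ [0,1) (taken from among θ_1, …, θ_ℓ) such that 1, ϑ_1, …, ϑ_m are linearly independent over ℚ, and complex polynomials p_{i,r} in 2m variables for 1 ≤ i ≤ ℓ and 0 ≤ r < R, such that for all i, r, n: λ_i^{nR+r} = ρ_i^{nR+r} · p_{i,r}(e^{2πi·{nϑ_1}}, e^{−2πi·{nϑ_1}}, …, e^{2πi·{nϑ_m}}, e^{−2πi·{nϑ_m}}), where {x} denotes the fractional part of x. -/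
/-- A finite family of reals contains a subfamily that, together with `1`, is linearly independent
over `ℚ`, and whose `ℚ`-span together with `1` contains the whole family. -/
theorem exists_linearIndependent_with_one (l : ℕ) (θ : Fin l → ℝ) :
    ∃ m : ℕ, m ≤ l ∧ ∃ e : Fin m → Fin l, Function.Injective e ∧
      (∀ (a : ℚ) (b : Fin m → ℚ),
        (a : ℝ) + ∑ j, (b j : ℝ) * θ (e j) = 0 → a = 0 ∧ ∀ j, b j = 0) ∧
      ∀ i, ∃ (a : ℚ) (b : Fin m → ℚ), θ i = (a : ℝ) + ∑ j, (b j : ℝ) * θ (e j) := by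
  let W : Submodule ℚ ℝ := Submodule.span ℚ {1}
  obtain ⟨κ, f, hf, hspan, hli⟩ := exists_linearIndependent' ℚ (fun i => W.mkQ (θ i))
  have : Finite κ := Finite.of_injective f hf
  have := Fintype.ofFinite κ
  let g := (Fintype.equivFin κ).symm
  have hinj : Function.Injective (f ∘ g) := hf.comp g.injective
  have hmk (b : Fin (Fintype.card κ) → ℚ) :
      ∑ j, b j • W.mkQ (θ (f (g j))) = W.mkQ (∑ j, (b j : ℝ) * θ (f (g j))) := by
    simp only [map_sum, ← Rat.smul_def, map_smul]
  refine ⟨Fintype.card κ, by simpa using Fintype.card_le_of_injective f hf, f ∘ g, hinj, ?_, ?_⟩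
  · intro a b h
    have hb : ∀ j, b j = 0 := by
      refine Fintype.linearIndependent_iff.1 (hli.comp g g.injective) b ?_
      have hmem : ∑ j, (b j : ℝ) * θ (f (g j)) ∈ W := by
        refine Submodule.mem_span_singleton.2 ⟨-a, ?_⟩
        simp only [Function.comp_apply] at h
        rw [Rat.smul_def]
        push_cast
        linarith
      have := (Submodule.Quotient.mk_eq_zero W).2 hmem
      exact (hmk b).trans this
    refine ⟨?_, hb⟩
    simpa [hb] using h
  · intro i
    have hi : W.mkQ (θ i) ∈ Submodule.span ℚ
        (Set.range fun j => W.mkQ (θ (f (g j)))) := by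
      have hr : (Set.range fun j => W.mkQ (θ (f (g j)))) =
          Set.range ((fun i => W.mkQ (θ i)) ∘ f) :=
        g.surjective.range_comp ((fun i => W.mkQ (θ i)) ∘ f)
      rw [hr, hspan]
      exact Submodule.subset_span ⟨i, rfl⟩
    obtain ⟨b, hb⟩ := (Submodule.mem_span_range_iff_exists_fun ℚ).1 hi
    rw [hmk] at hb
    obtain ⟨a, ha⟩ := Submodule.mem_span_singleton.1 ((Submodule.Quotient.eq W).1 hb.symm)
    refine ⟨a, b, ?_⟩
    rw [Rat.smul_def] at ha
    simp only [Function.comp_apply]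
    linarith

/-- Finitely many rationals have a common positive denominator. -/
theorem exists_common_denominator {ι : Type*} [Finite ι] (q : ι → ℚ) :
    ∃ R : ℕ, 1 ≤ R ∧ ∀ i, ∃ z : ℤ, (R : ℚ) * q i = z := by
  have := Fintype.ofFinite ι
  refine ⟨∏ i, (q i).den, Finset.prod_pos fun i _ => (q i).den_pos, fun i => ?_⟩
  obtain ⟨k, hk⟩ := Finset.dvd_prod_of_mem (fun i => (q i).den) (Finset.mem_univ i)
  refine ⟨k * (q i).num, ?_⟩
  rw [hk]
  push_cast
  rw [mul_comm ((q i).den : ℚ), mul_assoc, Rat.den_mul_eq_num]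

theorem exp_two_pi_I_mul_fract (x : ℝ) :
    Complex.exp (2 * (Real.pi : ℂ) * Complex.I * (Int.fract x : ℝ)) =
      Complex.exp (2 * (Real.pi : ℂ) * Complex.I * x) := by
  refine Complex.exp_eq_exp_iff_exists_int.2 ⟨-⌊x⌋, ?_⟩
  rw [Int.fract]
  push_cast
  ring

/-- A Laurent monomial in `exp (2πix)` is a monomial in `exp (2πi{x})` and `exp (-2πi{x})`. -/
theorem exp_fract_pow_mul_pow (x : ℝ) (z : ℤ) :
    Complex.exp (2 * (Real.pi : ℂ) * Complex.I * (Int.fract x : ℝ)) ^ z.toNat *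
      Complex.exp (-(2 * (Real.pi : ℂ) * Complex.I) * (Int.fract x : ℝ)) ^ (-z).toNat =
      Complex.exp (2 * (Real.pi : ℂ) * Complex.I * (z * x)) := by
  have hz : (z : ℂ) = (z.toNat : ℂ) - ((-z).toNat : ℂ) := by
    exact_mod_cast (Int.toNat_sub_toNat_neg z).symm
  rw [neg_mul, Complex.exp_neg, exp_two_pi_I_mul_fract, ← Complex.exp_neg, ← Complex.exp_nat_mul,
    ← Complex.exp_nat_mul, ← Complex.exp_add, hz]
  congr 1
  ring


/-- Given algebraic `λ_i = ρ_i · e^{2πi θ_i}` with `ρ_i > 0`,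
`θ_i ∈ [0,1)` and `e^{2πi θ_i}` algebraic, there are `R ≥ 1`, `m ≤ ℓ`, a choice
`ϑ_j = θ_{e(j)}` of `m` of the angles with `1, ϑ_1, …, ϑ_m` linearly independent over `ℚ`,
and complex polynomials `p_{i,r}` in `2m` variables such that
`λ_i^{nR+r} = ρ_i^{nR+r} · p_{i,r}(e^{2πi{nϑ_1}}, e^{-2πi{nϑ_1}}, …, e^{2πi{nϑ_m}}, e^{-2πi{nϑ_m}})`. -/
theorem stmt_7 (l : ℕ) (lam : Fin l → ℂ) (ρ : Fin l → ℝ) (θ : Fin l → ℝ)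
    (hρ : ∀ i, 0 < ρ i) (hθ : ∀ i, θ i ∈ Set.Ico (0 : ℝ) 1)
    (hγalg : ∀ i, IsAlgebraic ℚ (Complex.exp (2 * (Real.pi : ℂ) * Complex.I * (θ i : ℂ))))
    (hlam : ∀ i, lam i = (ρ i : ℂ) * Complex.exp (2 * (Real.pi : ℂ) * Complex.I * (θ i : ℂ)))
    (hlam_alg : ∀ i, IsAlgebraic ℚ (lam i)) :
    ∃ (R m : ℕ), 1 ≤ R ∧ m ≤ l ∧
    ∃ e : Fin m → Fin l, Function.Injective e ∧
      (∀ (a : ℚ) (b : Fin m → ℚ),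
        (a : ℝ) + ∑ j, (b j : ℝ) * θ (e j) = 0 → a = 0 ∧ ∀ j, b j = 0) ∧
    ∃ p : Fin l → Fin R → MvPolynomial (Fin m ⊕ Fin m) ℂ,
      ∀ (i : Fin l) (r : Fin R) (n : ℕ),
        lam i ^ (n * R + (r : ℕ)) = ((ρ i : ℂ)) ^ (n * R + (r : ℕ)) *
          MvPolynomial.eval
            (Sum.elim
              (fun j => Complex.exp (2 * (Real.pi : ℂ) * Complex.I *
                (Int.fract ((n : ℝ) * θ (e j)) : ℝ)))
              (fun j => Complex.exp (-(2 * (Real.pi : ℂ) * Complex.I) *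
                (Int.fract ((n : ℝ) * θ (e j)) : ℝ))))
            (p i r) := by
  obtain ⟨m, hm, e, he, hli, hrep⟩ := exists_linearIndependent_with_one l θ
  choose a b hab using hrep
  obtain ⟨R, hR, hden⟩ := exists_common_denominator
    (fun k : Fin l × Option (Fin m) => k.2.elim (a k.1) (b k.1))
  choose z hz using hden
  have hRθ (i : Fin l) :
      (R : ℝ) * θ i = z (i, none) + ∑ j, (z (i, some j) : ℝ) * θ (e j) := by
    have h0 : (R : ℝ) * a i = z (i, none) := by exact_mod_cast hz (i, none)
    have h1 (j : Fin m) : (R : ℝ) * b i j = z (i, some j) := by exact_mod_cast hz (i, some j)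
    rw [hab i, mul_add, h0, Finset.mul_sum]
    simp only [← mul_assoc, h1]
  refine ⟨R, m, hR, hm, e, he, hli, fun i r =>
    MvPolynomial.C (Complex.exp (2 * (Real.pi : ℂ) * Complex.I * (θ i : ℂ)) ^ (r : ℕ)) *
      ∏ j, (MvPolynomial.X (Sum.inl j) ^ (z (i, some j)).toNat *
        MvPolynomial.X (Sum.inr j) ^ (-z (i, some j)).toNat), fun i r n => ?_⟩
  simp only [map_mul, map_prod, map_pow, MvPolynomial.eval_C, MvPolynomial.eval_X,
    Sum.elim_inl, Sum.elim_inr, exp_fract_pow_mul_pow]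
  rw [hlam i, mul_pow, pow_add (Complex.exp _), mul_comm (_ ^ (n * R))]
  congr 2
  rw [← Complex.exp_nat_mul, ← Complex.exp_sum]
  refine Complex.exp_eq_exp_iff_exists_int.2 ⟨n * z (i, none), ?_⟩
  have hc : (R : ℂ) * θ i = z (i, none) + ∑ j, (z (i, some j) : ℂ) * θ (e j) := by
    exact_mod_cast congrArg (fun x : ℝ => (x : ℂ)) (hRθ i)
  have hs : ∑ j, 2 * (Real.pi : ℂ) * Complex.I *
      ((z (i, some j) : ℂ) * ((n : ℝ) * θ (e j) : ℝ)) =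
      2 * (Real.pi : ℂ) * Complex.I * n * ∑ j, (z (i, some j) : ℂ) * θ (e j) := by
    rw [Finset.mul_sum]
    refine Finset.sum_congr rfl fun j _ => ?_
    push_cast
    ring
  rw [hs]
  push_cast
  linear_combination 2 * (Real.pi : ℂ) * Complex.I * n * hc
end

section
/- Let (u_n)_{n∈ℕ} be a linear recurrence sequence over ℚ. If the limit L = lim_{n→∞} u_n exists (as a real number), then L is rational. -/
open Polynomial Filter Topology in
/-- Applying a polynomial `p` in the shift operator to a convergent sequence multiplies its limit
by `p(1)`. -/
theorem tendsto_aeval_funLeft_succ (p : ℚ[X]) {u : ℕ → ℚ} {L : ℝ}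
    (h : Tendsto (fun n => (u n : ℝ)) atTop (𝓝 L)) :
    Tendsto (fun n => ((aeval (LinearMap.funLeft ℚ ℚ Nat.succ) p u) n : ℝ)) atTop
      (𝓝 ((p.eval 1 : ℚ) * L)) := by
  induction p using Polynomial.induction_on generalizing u L with
  | C a =>
    simpa [Module.algebraMap_end_apply] using h.const_mul (a : ℝ)
  | add p q hp hq =>
    simpa [add_mul] using (hp h).add (hq h)
  | monomial n a ih =>
    have h' : Tendsto (fun n => ((LinearMap.funLeft ℚ ℚ Nat.succ u) n : ℝ)) atTop (𝓝 L) :=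
      h.comp (tendsto_add_atTop_nat 1)
    rw [pow_succ, ← mul_assoc, map_mul, aeval_X]
    simpa using ih h'

open Polynomial in
theorem aeval_funLeft_succ_X_pow_apply (k : ℕ) (u : ℕ → ℚ) (n : ℕ) :
    (aeval (LinearMap.funLeft ℚ ℚ Nat.succ) (X ^ k : ℚ[X]) u) n = u (n + k) := by
  induction k generalizing u with
  | zero => simp
  | succ k ih =>
    rw [pow_succ, map_mul, aeval_X, Module.End.mul_apply, ih]
    rfl

open Polynomial Filter Topology in
/-- A convergent sequence killed by a power of the difference operator is constant. -/
theorem eq_const_of_aeval_funLeft_succ_eq_zero (m : ℕ) {v : ℕ → ℚ} {L : ℝ}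
    (h : Tendsto (fun n => (v n : ℝ)) atTop (𝓝 L))
    (hv : aeval (LinearMap.funLeft ℚ ℚ Nat.succ) ((X - C 1 : ℚ[X]) ^ m) v = 0) (n : ℕ) :
    v n = v 0 := by
  induction m generalizing v L n with
  | zero =>
    have hv' : v = 0 := by simpa using hv
    simp [hv']
  | succ m ih =>
    rw [pow_succ, map_mul, Module.End.mul_apply] at hv
    have ht := tendsto_aeval_funLeft_succ (X - C 1) h
    have hc := ih ht hv
    simp only [hc] at ht
    have h0 := tendsto_nhds_unique ht tendsto_const_nhds
    have hd (k : ℕ) : v (k + 1) = v k := by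
      have h1 : aeval (LinearMap.funLeft ℚ ℚ Nat.succ) (X - C 1 : ℚ[X]) v k = 0 := by
        rw [hc k]
        have h2 := h0.symm
        rw [eval_sub, eval_X, eval_C, sub_self, Rat.cast_zero, zero_mul] at h2
        exact_mod_cast h2
      rw [map_sub, aeval_X, aeval_C, map_one, LinearMap.sub_apply, Pi.sub_apply] at h1
      exact sub_eq_zero.mp h1
    induction n with
    | zero => rfl
    | succ n hn => rw [hd, hn]

open Polynomial Filter Topology in
/-- If `(u_n)` is a linear recurrence sequence over `ℚ` and the real limit
`L = lim_{n→∞} u_n` exists, then `L` is rational. -/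
theorem stmt_13 (u : ℕ → ℚ)
    (hrec : ∃ D : ℕ, 1 ≤ D ∧ ∃ a : Fin D → ℚ,
      ∀ n : ℕ, u (n + D) = ∑ i : Fin D, a i * u (n + (i : ℕ)))
    (L : ℝ)
    (hlim : Filter.Tendsto (fun n : ℕ => (u n : ℝ)) Filter.atTop (nhds L)) :
    ∃ c : ℚ, L = (c : ℝ) := by
  obtain ⟨D, -, a, hu⟩ := hrec
  set S := LinearMap.funLeft ℚ ℚ Nat.succ
  set p : ℚ[X] := X ^ D - ∑ i : Fin D, C (a i) * X ^ (i : ℕ) with hp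
  have hp0 : p ≠ 0 := (monic_X_pow_sub (degree_sum_fin_lt a)).ne_zero
  have hpu : aeval S p u = 0 := by
    ext n
    rw [hp, map_sub, map_sum, LinearMap.sub_apply, Pi.sub_apply, aeval_funLeft_succ_X_pow_apply,
      hu, LinearMap.sum_apply, Finset.sum_apply, Pi.zero_apply, sub_eq_zero]
    refine Finset.sum_congr rfl fun i _ => ?_
    rw [map_mul, aeval_C, Module.End.mul_apply, Module.algebraMap_end_apply, Pi.smul_apply,
      aeval_funLeft_succ_X_pow_apply, smul_eq_mul]
  obtain ⟨q, hq, hdvd⟩ := exists_eq_pow_rootMultiplicity_mul_and_not_dvd p hp0 1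
  set m := p.rootMultiplicity 1
  obtain ⟨b, c, hbc⟩ : IsCoprime ((X - C 1 : ℚ[X]) ^ m) q :=
    (((irreducible_X_sub_C 1).coprime_iff_not_dvd).2 hdvd).pow_left
  have hv := tendsto_aeval_funLeft_succ (c * q) hlim
  have hw := tendsto_aeval_funLeft_succ (b * (X - C 1) ^ m) hlim
  have hvc := eq_const_of_aeval_funLeft_succ_eq_zero m hv (by
    rw [← Module.End.mul_apply, ← map_mul,
      show (X - C 1) ^ m * (c * q) = c * p by rw [hq]; ring, map_mul, Module.End.mul_apply, hpu,
      map_zero])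
  have hqw := tendsto_aeval_funLeft_succ q hw
  rw [← Module.End.mul_apply, ← map_mul,
    show q * (b * (X - C 1) ^ m) = b * p by rw [hq]; ring, map_mul, Module.End.mul_apply, hpu,
    map_zero] at hqw
  simp only [Pi.zero_apply, Rat.cast_zero] at hqw
  have hzero := tendsto_nhds_unique hqw tendsto_const_nhds
  have hq1 : ((q.eval 1 : ℚ) : ℝ) ≠ 0 := by
    rw [Rat.cast_ne_zero]
    exact fun h => hdvd (dvd_iff_isRoot.2 h)
  have hw0 := (mul_eq_zero.mp hzero).resolve_left hq1
  simp only [hvc] at hv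
  have hv0 := tendsto_nhds_unique hv tendsto_const_nhds
  refine ⟨_, Eq.trans ?_ hv0⟩
  have hsum := congrArg (fun r : ℚ[X] => ((r.eval 1 : ℚ) : ℝ) * L) hbc
  simp only [eval_add, Rat.cast_add, add_mul, hw0, zero_add, eval_one, Rat.cast_one,
    one_mul] at hsum
  exact hsum.symm
end
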